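/- As ν → +∞, x*_ν − (ν + (7ν)^{1/3}/4) = O(ν^{−1/3}) and z*_ν − (π/4 + √(7/18)) = O(ν^{−2/3}). -/

import Mathlib

/-- The lower bound for the phase of Bessel derivatives:
`φlo_ν(x) := √(x² − ν²) − ν·arccos(ν/x) + π/4`. -/
noncomputable def phiLo (ν x : ℝ) : ℝ :=
  Real.sqrt (x ^ 2 - ν ^ 2) - ν * Real.arccos (ν / x) + Real.pi / 4

/-- The upper bound for the phase of Bessel derivatives:
`φup_ν(x) := φlo_ν(x) + (9x² − 2ν²)/(24(x² − ν²)^{3/2})`. -/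
noncomputable def phiUp (ν x : ℝ) : ℝ :=
  phiLo ν x + (9 * x ^ 2 - 2 * ν ^ 2) / (24 * Real.sqrt (x ^ 2 - ν ^ 2) ^ 3)

/-- The polynomial `p_ν(x) := 8x⁶ − 3(8ν² + 1)x⁴ + 4ν²(6ν² − 1)x² − 8ν⁶`. -/
noncomputable def pPoly (ν x : ℝ) : ℝ :=
  8 * x ^ 6 - 3 * (8 * ν ^ 2 + 1) * x ^ 4 + 4 * ν ^ 2 * (6 * ν ^ 2 - 1) * x ^ 2 - 8 * ν ^ 6

open Real in
theorem sub_cube_div_three_le_arctan {k : ℝ} (hk : 0 ≤ k) : k - k ^ 3 / 3 ≤ arctan k := by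
  have hd : ∀ y : ℝ, HasDerivAt (fun y : ℝ => arctan y - (y - y ^ 3 / 3))
      (1 / (1 + y ^ 2) - (1 - 3 * y ^ 2 / 3)) y := fun y => by
    simpa using (hasDerivAt_arctan y).fun_sub ((hasDerivAt_id' y).fun_sub ((hasDerivAt_pow 3 y).div_const 3))
  have hm : Monotone (fun y : ℝ => arctan y - (y - y ^ 3 / 3)) := by
    refine monotone_of_hasDerivAt_nonneg hd fun y => ?_
    have : 1 / (1 + y ^ 2) - (1 - 3 * y ^ 2 / 3) = y ^ 4 / (1 + y ^ 2) := by
      field_simp; ring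
    simp only [Pi.zero_apply, this]; positivity
  simpa using hm hk

open Real in
theorem arctan_le_sub_cube_add_pow_five {k : ℝ} (hk : 0 ≤ k) :
    arctan k ≤ k - k ^ 3 / 3 + k ^ 5 / 5 := by
  have hd : ∀ y : ℝ, HasDerivAt (fun y : ℝ => y - y ^ 3 / 3 + y ^ 5 / 5 - arctan y)
      (1 - 3 * y ^ 2 / 3 + 5 * y ^ 4 / 5 - 1 / (1 + y ^ 2)) y := fun y => by
    simpa using (((hasDerivAt_id' y).fun_sub ((hasDerivAt_pow 3 y).div_const 3)).fun_add
      ((hasDerivAt_pow 5 y).div_const 5)).fun_sub (hasDerivAt_arctan y)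
  have hm : Monotone (fun y : ℝ => y - y ^ 3 / 3 + y ^ 5 / 5 - arctan y) := by
    refine monotone_of_hasDerivAt_nonneg hd fun y => ?_
    have : 1 - 3 * y ^ 2 / 3 + 5 * y ^ 4 / 5 - 1 / (1 + y ^ 2) = y ^ 6 / (1 + y ^ 2) := by
      field_simp; ring
    simp only [Pi.zero_apply, this]; positivity
  simpa using hm hk

/-- With `ν = t³`, a root `x` of `pPoly ν` satisfies `x² = ν² + a t⁴` where `8 a³ = 7 + O(t⁻²)`. -/
theorem exists_scaled_root {t x : ℝ} (ht : 1 ≤ t) (hx : t ^ 3 < x) (hp : pPoly (t ^ 3) x = 0) :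
    ∃ a : ℝ, x ^ 2 = t ^ 6 + a * t ^ 4 ∧ 0 < a ∧ a ≤ 2 ∧ 7 ≤ 8 * a ^ 3 ∧
      (8 * a ^ 3 - 7) * t ^ 2 ≤ 32 := by
  have ht0 : 0 < t := by linarith
  have hw : 0 < x ^ 2 - t ^ 6 := by
    have := mul_self_lt_mul_self (by positivity) hx
    nlinarith
  obtain ⟨a, ha⟩ : ∃ a, a = (x ^ 2 - t ^ 6) / t ^ 4 := ⟨_, rfl⟩
  have ha0 : 0 < a := ha ▸ by positivity
  have hxa : x ^ 2 = t ^ 6 + a * t ^ 4 := by rw [ha]; field_simp; ring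
  have ht2 : 1 ≤ t ^ 2 := one_le_pow₀ ht
  have hroot : (8 * a ^ 3 - 7) * t ^ 4 = 3 * a ^ 2 + 10 * a * t ^ 2 := by
    have h : t ^ 8 * ((8 * a ^ 3 - 7) * t ^ 4 - (3 * a ^ 2 + 10 * a * t ^ 2)) = 0 := by
      rw [← hp, pPoly, show x ^ 6 = (x ^ 2) ^ 3 by ring, show x ^ 4 = (x ^ 2) ^ 2 by ring, hxa]
      ring
    have := (mul_eq_zero.mp h).resolve_left (by positivity)
    linarith
  have hle : (8 * a ^ 3 - 7) * t ^ 2 ≤ 3 * a ^ 2 + 10 * a := by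
    have h : (8 * a ^ 3 - 7) * t ^ 2 * t ^ 2 ≤ (3 * a ^ 2 + 10 * a) * t ^ 2 := by
      nlinarith [mul_nonneg (sq_nonneg a) (sub_nonneg.2 ht2)]
    exact le_of_mul_le_mul_right h (by positivity)
  have h7 : 0 ≤ 8 * a ^ 3 - 7 := by
    have : 0 ≤ (8 * a ^ 3 - 7) * t ^ 4 := by rw [hroot]; positivity
    exact nonneg_of_mul_nonneg_left this (by positivity)
  have ha2 : a ≤ 2 := by
    by_contra! h
    have h1 : 8 * a ^ 3 - 7 ≤ 3 * a ^ 2 + 10 * a := by nlinarith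
    nlinarith [mul_pos (sub_pos.2 h) (sub_pos.2 h), mul_pos (mul_pos ha0 ha0) (sub_pos.2 h)]
  exact ⟨a, hxa, ha0, ha2, by linarith, by nlinarith⟩

theorem abs_root_sub_le {t x c : ℝ} (ht : 1 ≤ t) (hx : t ^ 3 < x) (hp : pPoly (t ^ 3) x = 0)
    (hc0 : 0 ≤ c) (hc : c ^ 3 = 7) : |x - (t ^ 3 + c * t / 4)| ≤ 9 / t := by
  obtain ⟨a, hxa, ha0, ha2, h7, h32⟩ := exists_scaled_root ht hx hp
  have ht0 : 0 < t := by linarith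
  have hc1 : 1 ≤ c := by
    by_contra! h
    nlinarith [pow_le_one₀ (n := 3) hc0 h.le]
  have hca : c ≤ 2 * a := by
    refine le_of_pow_le_pow_left₀ (n := 3) (by norm_num) (by positivity) ?_
    nlinarith
  have hac : (2 * a - c) * t ^ 2 ≤ 32 := by
    have h : 2 * a - c ≤ 8 * a ^ 3 - 7 := by
      have : 8 * a ^ 3 - 7 = (2 * a - c) * ((2 * a) ^ 2 + 2 * a * c + c ^ 2) := by
        rw [← hc]; ring
      rw [this]
      exact le_mul_of_one_le_right (by linarith) (by nlinarith [mul_pos ha0 ha0])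
    nlinarith [mul_le_mul_of_nonneg_right h (sq_nonneg t)]
  have hx0 : 0 < x := lt_trans (by positivity) hx
  have hup : x ≤ t ^ 3 + a * t / 2 := by
    refine le_of_sq_le_sq ?_ (by positivity)
    nlinarith [sq_nonneg (a * t)]
  have hlo : t ^ 3 + a * t / 2 - a ^ 2 / (8 * t) ≤ x := by
    refine le_of_sq_le_sq ?_ hx0.le
    have h : (t ^ 3 + a * t / 2 - a ^ 2 / (8 * t)) ^ 2
        = t ^ 6 + a * t ^ 4 - a ^ 3 / (64 * t ^ 2) * (8 * t ^ 2 - a) := by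
      field_simp; ring
    rw [h, hxa]
    have : 0 ≤ a ^ 3 / (64 * t ^ 2) * (8 * t ^ 2 - a) :=
      mul_nonneg (by positivity) (by nlinarith)
    linarith
  have e1 : a * t / 2 - c * t / 4 ≤ 8 / t := by
    rw [le_div_iff₀ ht0]; nlinarith
  have e2 : 0 ≤ a * t / 2 - c * t / 4 := by nlinarith
  have e3 : a ^ 2 / (8 * t) ≤ 1 / t := by
    rw [div_le_div_iff₀ (by positivity) ht0]; nlinarith
  have e4 : 9 / t = 8 / t + 1 / t := by ring
  have e5 : 0 < 1 / t := by positivity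
  have e6 : 0 < 8 / t := by positivity
  rw [abs_le]; constructor <;> linarith

theorem phiUp_eq_arctan {ν x : ℝ} (hν : 0 < ν) (hx : ν < x) :
    phiUp ν x = √(x ^ 2 - ν ^ 2) - ν * Real.arctan (√(x ^ 2 - ν ^ 2) / ν) + Real.pi / 4
      + (9 * x ^ 2 - 2 * ν ^ 2) / (24 * √(x ^ 2 - ν ^ 2) ^ 3) := by
  have hx0 : 0 < x := hν.trans hx
  have h : √(1 - (ν / x) ^ 2) / (ν / x) = √(x ^ 2 - ν ^ 2) / ν := by
    rw [show 1 - (ν / x) ^ 2 = (x ^ 2 - ν ^ 2) / x ^ 2 by field_simp,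
      Real.sqrt_div' _ (sq_nonneg x), Real.sqrt_sq hx0.le]
    field_simp
  rw [phiUp, phiLo, Real.arccos_eq_arctan (by positivity), h]

theorem abs_phiUp_root_sub_le {t x : ℝ} (ht : 1 ≤ t) (hx : t ^ 3 < x)
    (hp : pPoly (t ^ 3) x = 0) :
    |phiUp (t ^ 3) x - (Real.pi / 4 + √(7 / 18))| ≤ 10 / t ^ 2 := by
  obtain ⟨a, hxa, ha0, ha2, h7, h32⟩ := exists_scaled_root ht hx hp
  have ht0 : 0 < t := by linarith
  obtain ⟨b, hb⟩ : ∃ b, b = √a := ⟨_, rfl⟩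
  have hb0 : 0 < b := hb ▸ Real.sqrt_pos.2 ha0
  have hba : b ^ 2 = a := by rw [hb, Real.sq_sqrt ha0.le]
  obtain ⟨q, hq⟩ : ∃ q, q = √(7 / 8) := ⟨_, rfl⟩
  have hq0 : 0 < q := hq ▸ Real.sqrt_pos.2 (by norm_num)
  have hq2 : q ^ 2 = 7 / 8 := by rw [hq, Real.sq_sqrt (by norm_num)]
  have hq78 : 7 / 8 ≤ q := by nlinarith only [hq0, hq2]
  have hqt : √(7 / 18) = q / 3 + q / 3 := by
    rw [Real.sqrt_eq_iff_mul_self_eq (by norm_num) (by positivity)]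
    linarith
  have hs : √(x ^ 2 - (t ^ 3) ^ 2) = b * t ^ 2 := by
    rw [show x ^ 2 - (t ^ 3) ^ 2 = (b * t ^ 2) ^ 2 by rw [hxa, ← hba]; ring,
      Real.sqrt_sq (by positivity)]
  have hb6 : b ^ 3 * b ^ 3 = a ^ 3 := by rw [← hba]; ring
  have hqb : q ≤ b ^ 3 := by
    refine le_of_sq_le_sq ?_ (by positivity)
    linarith
  have hbq : b ^ 3 - q ≤ 4 / t ^ 2 := by
    rw [le_div_iff₀ (by positivity)]
    have h : b ^ 3 - q ≤ a ^ 3 - 7 / 8 := by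
      rw [← hb6, ← hq2]
      nlinarith only [hqb, hq78]
    linarith [mul_le_mul_of_nonneg_right h (sq_nonneg t)]
  have hk0 : 0 ≤ b / t := by positivity
  have hkdiv : b * t ^ 2 / t ^ 3 = b / t := by field_simp
  have e1 : b * t ^ 2 - t ^ 3 * Real.arctan (b / t) ≤ b ^ 3 / 3 := by
    have := mul_le_mul_of_nonneg_left (sub_cube_div_three_le_arctan hk0) (pow_pos ht0 3).le
    have h : t ^ 3 * (b / t - (b / t) ^ 3 / 3) = b * t ^ 2 - b ^ 3 / 3 := by field_simp
    linarith
  have e2 : b ^ 3 / 3 - b ^ 5 / 5 / t ^ 2 ≤ b * t ^ 2 - t ^ 3 * Real.arctan (b / t) := by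
    have := mul_le_mul_of_nonneg_left (arctan_le_sub_cube_add_pow_five hk0) (pow_pos ht0 3).le
    have h : t ^ 3 * (b / t - (b / t) ^ 3 / 3 + (b / t) ^ 5 / 5)
      = b * t ^ 2 - b ^ 3 / 3 + b ^ 5 / 5 / t ^ 2 := by field_simp
    linarith
  have hb2 : b ≤ 2 := by nlinarith only [hba, ha2]
  have e3 : b ^ 5 / 5 / t ^ 2 ≤ 2 / t ^ 2 := by
    have : b ^ 5 / 5 ≤ 2 := by
      have : b ^ 5 = a ^ 2 * b := by rw [← hba]; ring
      linarith [mul_le_mul (show a ^ 2 ≤ 4 by nlinarith only [ha0, ha2]) hb2 hb0.le (by norm_num)]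
    gcongr
  have e4 : (9 * x ^ 2 - 2 * (t ^ 3) ^ 2) / (24 * (b * t ^ 2) ^ 3)
      = 3 / (8 * b) / t ^ 2 + q ^ 2 / (3 * b ^ 3) := by
    rw [hq2, hxa, ← hba]; field_simp; ring
  have hb12 : 1 / 2 ≤ b := by
    by_contra! h
    linarith [pow_le_pow_left₀ hb0.le h.le 3]
  have e5 : 3 / (8 * b) / t ^ 2 ≤ 1 / t ^ 2 := by
    have : 3 / (8 * b) ≤ 1 := by rw [div_le_one (by positivity)]; linarith
    gcongr
  have e6 : q ^ 2 / (3 * b ^ 3) ≤ q / 3 := by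
    rw [div_le_div_iff₀ (by positivity) (by norm_num)]
    linarith [mul_le_mul_of_nonneg_left hqb hq0.le]
  have e7 : q / 3 - (b ^ 3 - q) / 3 ≤ q ^ 2 / (3 * b ^ 3) := by
    rw [le_div_iff₀ (by positivity)]
    linarith [sq_nonneg (b ^ 3 - q)]
  have e8 : 0 < 3 / (8 * b) / t ^ 2 := by positivity
  have e9 : 0 < 1 / t ^ 2 := by positivity
  rw [phiUp_eq_arctan (by positivity) hx, hs, hkdiv, e4, hqt]
  rw [div_eq_mul_one_div 4] at hbq
  rw [div_eq_mul_one_div 2] at e3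
  rw [div_eq_mul_one_div 10, abs_le]
  constructor <;> linarith

/-- Asymptotics of `x*_ν` and `z*_ν = φup_ν(x*_ν)` as `ν → +∞`:
`x*_ν = ν + (7ν)^{1/3}/4 + O(ν^{−1/3})` and `z*_ν = π/4 + √(7/18) + O(ν^{−2/3})`. -/
theorem xstar_zstar_asymptotics (xstar : ℝ → ℝ)
    (hxstar : ∀ ν, 0 ≤ ν → ν < xstar ν ∧ pPoly ν (xstar ν) = 0 ∧
      ∀ y, ν < y → pPoly ν y = 0 → y = xstar ν) :
    Asymptotics.IsBigO Filter.atTop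
      (fun ν : ℝ => xstar ν - (ν + (7 * ν) ^ ((1 : ℝ) / 3) / 4))
      (fun ν : ℝ => ν ^ (-(1 : ℝ) / 3)) ∧
    Asymptotics.IsBigO Filter.atTop
      (fun ν : ℝ => phiUp ν (xstar ν) - (Real.pi / 4 + Real.sqrt (7 / 18)))
      (fun ν : ℝ => ν ^ (-(2 : ℝ) / 3)) := by
  have key : ∀ ν : ℝ, 1 ≤ ν → 1 ≤ ν ^ ((1 : ℝ) / 3) ∧ (ν ^ ((1 : ℝ) / 3)) ^ 3 = ν := fun ν hν =>
    ⟨Real.one_le_rpow hν (by norm_num), by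
      rw [← Real.rpow_natCast, ← Real.rpow_mul (by linarith)]; norm_num⟩
  refine ⟨Asymptotics.IsBigO.of_bound 9 ?_, Asymptotics.IsBigO.of_bound 10 ?_⟩
  all_goals
    filter_upwards [Filter.eventually_ge_atTop 1] with ν hν
    obtain ⟨ht, htν⟩ := key ν hν
    have hν0 : 0 ≤ ν := by linarith
    obtain ⟨hx, hp, -⟩ := hxstar ν hν0
    rw [Real.norm_eq_abs, Real.norm_of_nonneg (by positivity)]
  · have h := abs_root_sub_le (c := 7 ^ ((1 : ℝ) / 3)) ht (by rwa [htν]) (by rwa [htν])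
      (by positivity) (by rw [← Real.rpow_natCast, ← Real.rpow_mul (by norm_num)]; norm_num)
    rwa [htν, ← Real.mul_rpow (by norm_num) hν0, div_eq_mul_inv 9, ← Real.rpow_neg hν0,
      ← neg_div] at h
  · have h := abs_phiUp_root_sub_le ht (by rwa [htν]) (by rwa [htν])
    rwa [htν, div_eq_mul_inv 10, ← Real.rpow_natCast, ← Real.rpow_mul hν0, ← Real.rpow_neg hν0,
      show -((1 : ℝ) / 3 * (2 : ℕ)) = -2 / 3 by norm_num] at h
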